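/- Let η ∈ (0, 1/2] be such that 1/(2η) is a positive integer, let β be a positive integer, and set α := 100/η and T := 3αβ (so α and T are positive integers). Define the reward sequence r^{(1)},…,r^{(T)} ∈ {0,1}³ in β identical batches of length 3α: within batch i (rounds 3α(i−1)+1,…,3αi), r^{(t)} := (1,1,0) for the first α rounds (Phase 1), r^{(t)} := (0,1,0) for the next α rounds (Phase 2), and r^{(t)} := (0,0,1) for the last α rounds (Phase 3). Let Δ₂ := {π ∈ ℝ³ : π_k ≥ 0, π_1 + π_2 + π_3 = 1} and let Proj(y) denote the unique point of Δ₂ nearest to y in Euclidean norm. Define the agile online gradient ascent iterates by π^{(1)} := (1/3, 1/3, 1/3) and π^{(t+1)} := Proj(π^{(t)} + η·r^{(t)}) for t = 1,…,T−1. Then the swap regret of this sequence satisfies max over maps ψ : {1,2,3} → {1,2,3} of Σ_{t=1}^{T} Σ_{k=1}^{3} π_k^{(t)}·( r_{ψ(k)}^{(t)} − r_k^{(t)} ) ≥ T/1200. -/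

import Mathlib

/-- The Euclidean distance on `ℝ³` (represented as `Fin 3 → ℝ`). -/
noncomputable def eudist (u w : Fin 3 → ℝ) : ℝ :=
  Real.sqrt (∑ i, (u i - w i) ^ 2)

/-- The standard simplex `Δ₂ ⊆ ℝ³`. -/
def simplex2 : Set (Fin 3 → ℝ) :=
  {π | (∀ i, 0 ≤ π i) ∧ π 0 + π 1 + π 2 = 1}

/-- The reward sequence of the hard instance, in identical batches of length `3·α`
(rounds indexed from `0`): within each batch, `r = (1,1,0)` for the first `α` rounds
(Phase 1), `r = (0,1,0)` for the next `α` rounds (Phase 2), and `r = (0,0,1)` for the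
last `α` rounds (Phase 3). -/
def rSeq (α : ℕ) (t : ℕ) : Fin 3 → ℝ :=
  if t % (3 * α) < α then ![1, 1, 0]
  else if t % (3 * α) < 2 * α then ![0, 1, 0]
  else ![0, 0, 1]

/-- Optimality conditions for the Euclidean projection `p` of `y` onto the simplex. -/
lemma exists_multiplier_of_nearest {p y : Fin 3 → ℝ} (hp : p ∈ simplex2)
    (hmin : ∀ z ∈ simplex2, eudist p y ≤ eudist z y) :
    ∃ l : ℝ, ∀ i, y i - p i ≤ l ∧ (p i = 0 ∨ p i = y i - l) := by
  have hvar : ∀ z ∈ simplex2, ∑ i, (y i - p i) * (z i - p i) ≤ 0 := by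
    intro z hz
    have hs : ∀ s : ℝ, 0 < s → s ≤ 1 →
        2 * ∑ i, (y i - p i) * (z i - p i) ≤ s * ∑ i, (z i - p i) ^ 2 := by
      intro s hs0 hs1
      have hmem : (fun i => p i + s * (z i - p i)) ∈ simplex2 := by
        refine ⟨fun i => ?_, ?_⟩
        · nlinarith [mul_nonneg (sub_nonneg.2 hs1) (hp.1 i), mul_nonneg hs0.le (hz.1 i)]
        · linear_combination (1 - s) * hp.2 + s * hz.2
      have h := hmin _ hmem
      unfold eudist at h
      rw [Real.sqrt_le_sqrt_iff (Finset.sum_nonneg fun i _ => sq_nonneg _)] at h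
      simp only [Fin.sum_univ_three] at h ⊢
      refine le_of_mul_le_mul_left ?_ hs0
      linarith
    by_contra! hpos
    set A := ∑ i, (y i - p i) * (z i - p i)
    have hB : 0 ≤ ∑ i, (z i - p i) ^ 2 := Finset.sum_nonneg fun i _ => sq_nonneg _
    set B := ∑ i, (z i - p i) ^ 2
    have h := hs (A / (A + B)) (by positivity) ((div_le_one (by positivity)).2 (by linarith))
    have h1 : A / (A + B) * B ≤ A := by
      rw [div_mul_eq_mul_div, div_le_iff₀ (by positivity)]
      nlinarith
    linarith
  have hle : ∀ j, y j - p j ≤ ∑ i, (y i - p i) * p i := by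
    intro j
    have h := hvar (Pi.single j 1) (by
      refine ⟨fun i => ?_, ?_⟩
      · by_cases h : i = j
        · subst h; simp
        · simp [h]
      · fin_cases j <;> simp)
    have h2 : ∑ i, (y i - p i) * ((Pi.single j 1 : Fin 3 → ℝ) i - p i)
        = (y j - p j) - ∑ i, (y i - p i) * p i := by
      simp [mul_sub, Finset.sum_sub_distrib, Pi.single_apply]
    linarith
  refine ⟨∑ i, (y i - p i) * p i, fun i => ⟨hle i, ?_⟩⟩
  have hsum : ∑ j, p j * ((∑ i, (y i - p i) * p i) - (y j - p j)) = 0 := by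
    have := hp.2
    simp only [Fin.sum_univ_three]
    linear_combination
      ((y 0 - p 0) * p 0 + (y 1 - p 1) * p 1 + (y 2 - p 2) * p 2) * this
  have hz := (Finset.sum_eq_zero_iff_of_nonneg
    (fun j _ => mul_nonneg (hp.1 j) (sub_nonneg.2 (hle j)))).1 hsum i (Finset.mem_univ i)
  rcases mul_eq_zero.1 hz with h | h
  · exact Or.inl h
  · exact Or.inr (by linarith)

/-- `p` is a Euclidean projection of `q + η • r` onto the simplex. -/
def IsAscentStep (η : ℝ) (r q p : Fin 3 → ℝ) : Prop :=
  p ∈ simplex2 ∧ ∀ z ∈ simplex2,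
    eudist p (fun i => q i + η * r i) ≤ eudist z (fun i => q i + η * r i)

lemma IsAscentStep.reward_110 {η : ℝ} (hη : 0 < η) {q p : Fin 3 → ℝ} (hq : q ∈ simplex2)
    (h : IsAscentStep η ![1, 1, 0] q p) (h01 : q 0 = q 1) :
    p 0 = p 1 ∧ p 2 ≤ max 0 (q 2 - η / 2) := by
  obtain ⟨l, hl⟩ := exists_multiplier_of_nearest h.1 h.2
  obtain ⟨hp, hps⟩ := h.1
  obtain ⟨hq, hqs⟩ := hq
  have a0 := hl 0
  have a1 := hl 1
  have a2 := hl 2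
  simp at a0 a1 a2
  have p0 := hp 0
  have p1 := hp 1
  have p2 := hp 2
  have q0 := hq 0
  have q1 := hq 1
  have q2 := hq 2
  obtain ⟨b0, c0⟩ := a0
  obtain ⟨b1, c1⟩ := a1
  obtain ⟨b2, c2⟩ := a2
  have h01' : p 0 = p 1 := by
    rcases c0 with c0 | c0 <;> rcases c1 with c1 | c1 <;> linarith
  refine ⟨h01', ?_⟩
  rw [le_max_iff]
  rcases c2 with c2 | c2
  · left; linarith
  · right
    rcases c0 with c0 | c0 <;> linarith

lemma IsAscentStep.reward_010 {η : ℝ} (hη : 0 < η) {q p : Fin 3 → ℝ} (hq : q ∈ simplex2)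
    (h : IsAscentStep η ![0, 1, 0] q p) : q 0 - η / 2 ≤ p 0 := by
  obtain ⟨l, hl⟩ := exists_multiplier_of_nearest h.1 h.2
  obtain ⟨hp, hps⟩ := h.1
  obtain ⟨hq, hqs⟩ := hq
  have a0 := hl 0
  have a1 := hl 1
  have a2 := hl 2
  simp at a0 a1 a2
  have p0 := hp 0
  have p1 := hp 1
  have p2 := hp 2
  have q0 := hq 0
  have q1 := hq 1
  have q2 := hq 2
  obtain ⟨b0, c0⟩ := a0
  obtain ⟨b1, c1⟩ := a1
  obtain ⟨b2, c2⟩ := a2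
  by_contra! hlt
  rcases c0 with c0 | c0 <;> rcases c1 with c1 | c1 <;> rcases c2 with c2 | c2 <;> linarith

lemma IsAscentStep.reward_001 {η : ℝ} (hη : 0 < η) {q p : Fin 3 → ℝ} (hq : q ∈ simplex2)
    (h : IsAscentStep η ![0, 0, 1] q p) : min 1 (q 2 + η / 2) ≤ p 2 := by
  obtain ⟨l, hl⟩ := exists_multiplier_of_nearest h.1 h.2
  obtain ⟨hp, hps⟩ := h.1
  obtain ⟨hq, hqs⟩ := hq
  have a0 := hl 0
  have a1 := hl 1
  have a2 := hl 2
  simp at a0 a1 a2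
  have p0 := hp 0
  have p1 := hp 1
  have p2 := hp 2
  have q0 := hq 0
  have q1 := hq 1
  have q2 := hq 2
  obtain ⟨b0, c0⟩ := a0
  obtain ⟨b1, c1⟩ := a1
  obtain ⟨b2, c2⟩ := a2
  by_contra! hlt
  rw [lt_min_iff] at hlt
  obtain ⟨hlt1, hlt2⟩ := hlt
  rcases c0 with c0 | c0 <;> rcases c1 with c1 | c1 <;> linarith

lemma rSeq_phase_one {α b s : ℕ} (hs : s < α) : rSeq α (3 * α * b + s) = ![1, 1, 0] := by
  have : (3 * α * b + s) % (3 * α) = s := by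
    rw [Nat.mul_add_mod, Nat.mod_eq_of_lt (by omega)]
  simp [rSeq, this, hs]

lemma rSeq_phase_two {α b s : ℕ} (hs : s < α) :
    rSeq α (3 * α * b + (α + s)) = ![0, 1, 0] := by
  have : (3 * α * b + (α + s)) % (3 * α) = α + s := by
    rw [Nat.mul_add_mod, Nat.mod_eq_of_lt (by omega)]
  unfold rSeq
  rw [this, if_neg (by omega), if_pos (by omega)]

lemma rSeq_phase_three {α b s : ℕ} (hs : s < α) :
    rSeq α (3 * α * b + (2 * α + s)) = ![0, 0, 1] := by
  have : (3 * α * b + (2 * α + s)) % (3 * α) = 2 * α + s := by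
    rw [Nat.mul_add_mod, Nat.mod_eq_of_lt (by omega)]
  unfold rSeq
  rw [this, if_neg (by omega), if_neg (by omega)]

lemma rSeq_zero_le_one (α t : ℕ) : 0 ≤ rSeq α t 1 - rSeq α t 0 := by
  unfold rSeq
  split_ifs <;> simp

section Iterates

variable {η : ℝ} {α : ℕ} {π : ℕ → Fin 3 → ℝ}

lemma half_le_of_phase_one (hη : 0 < η) (hα : η * α = 100) (hmem : ∀ t, π t ∈ simplex2)
    (hstep : ∀ t, IsAscentStep η (rSeq α t) (π t) (π (t + 1))) {b : ℕ}
    (hb : π (3 * α * b) 0 = π (3 * α * b) 1) : 1 / 2 ≤ π (3 * α * b + α) 0 := by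
  have key : ∀ s ≤ α, π (3 * α * b + s) 0 = π (3 * α * b + s) 1 ∧
      π (3 * α * b + s) 2 ≤ max 0 (1 - η * s / 2) := by
    intro s
    induction s with
    | zero =>
      intro _
      have h := hmem (3 * α * b)
      refine ⟨hb, le_max_of_le_right ?_⟩
      have h0 := h.1 0
      have h1 := h.1 1
      have h2 := h.2
      simp only [add_zero, Nat.cast_zero, mul_zero, zero_div, sub_zero]
      linarith
    | succ s ih =>
      intro hs
      obtain ⟨ih1, ih2⟩ := ih (by omega)
      have h := hstep (3 * α * b + s)
      rw [rSeq_phase_one (by omega)] at h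
      obtain ⟨h1, h2⟩ := h.reward_110 hη (hmem _) ih1
      refine ⟨h1, h2.trans (max_le (le_max_left _ _) ?_)⟩
      push_cast
      rcases le_max_iff.1 ih2 with h3 | h3
      · exact le_max_of_le_left (by linarith)
      · exact le_max_of_le_right (by linarith)
  obtain ⟨h1, h2⟩ := key α le_rfl
  rw [hα, max_eq_left (by norm_num)] at h2
  linarith [(hmem (3 * α * b + α)).2]

lemma le_of_phase_two (hη : 0 < η) (hmem : ∀ t, π t ∈ simplex2)
    (hstep : ∀ t, IsAscentStep η (rSeq α t) (π t) (π (t + 1))) {b : ℕ}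
    (hb : 1 / 2 ≤ π (3 * α * b + α) 0) :
    ∀ s ≤ α, 1 / 2 - η * s / 2 ≤ π (3 * α * b + (α + s)) 0 := by
  intro s
  induction s with
  | zero => intro _; simpa using hb
  | succ s ih =>
    intro hs
    have h := hstep (3 * α * b + (α + s))
    rw [rSeq_phase_two (by omega)] at h
    have h1 := h.reward_010 hη (hmem _)
    have h2 := ih (by omega)
    have h3 : 3 * α * b + (α + s) + 1 = 3 * α * b + (α + (s + 1)) := by ring
    rw [h3] at h1
    push_cast
    linarith

lemma eq_of_phase_three (hη : 0 < η) (hα : η * α = 100) (hmem : ∀ t, π t ∈ simplex2)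
    (hstep : ∀ t, IsAscentStep η (rSeq α t) (π t) (π (t + 1))) (b : ℕ) :
    π (3 * α * (b + 1)) 0 = π (3 * α * (b + 1)) 1 := by
  have key : ∀ s ≤ α, min 1 (η * s / 2) ≤ π (3 * α * b + (2 * α + s)) 2 := by
    intro s
    induction s with
    | zero => intro _; simpa using (hmem (3 * α * b + 2 * α)).1 2
    | succ s ih =>
      intro hs
      have h := hstep (3 * α * b + (2 * α + s))
      rw [rSeq_phase_three (by omega)] at h
      refine le_trans (le_min (min_le_left _ _) ?_) (h.reward_001 hη (hmem _))
      push_cast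
      rcases min_le_iff.1 (ih (by omega)) with h3 | h3
      · exact (min_le_left _ _).trans (by linarith)
      · exact (min_le_right _ _).trans (by linarith)
  have h := key α le_rfl
  rw [hα, min_eq_left (by norm_num), show 3 * α * b + (2 * α + α) = 3 * α * (b + 1) by ring] at h
  have hm := hmem (3 * α * (b + 1))
  linarith [hm.1 0, hm.1 1, hm.2]

lemma eq_of_batch_start (hη : 0 < η) (hα : η * α = 100) (hπ0 : π 0 = ![1 / 3, 1 / 3, 1 / 3])
    (hmem : ∀ t, π t ∈ simplex2)
    (hstep : ∀ t, IsAscentStep η (rSeq α t) (π t) (π (t + 1))) (b : ℕ) :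
    π (3 * α * b) 0 = π (3 * α * b) 1 := by
  cases b with
  | zero => simp [hπ0]
  | succ b => exact eq_of_phase_three hη hα hmem hstep b

end Iterates

lemma sum_range_half_sub (η : ℝ) (n : ℕ) :
    ∑ s ∈ Finset.range n, (1 / 2 - η * s / 2) = n / 2 - η * (n * (n - 1)) / 4 := by
  induction n with
  | zero => simp
  | succ n ih =>
    rw [Finset.sum_range_succ, ih]
    push_cast
    ring

/-- **agile online gradient ascent has linear swap regret.** Let
`η ∈ (0, 1/2]` with `1/(2η)` a positive integer, `β` a positive integer, `α = 100/η`,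
`T = 3αβ`. If `π⁽⁰⁾ = (1/3,1/3,1/3)` and each `π⁽ᵗ⁺¹⁾` is the Euclidean projection onto
`Δ₂` of `π⁽ᵗ⁾ + η·r⁽ᵗ⁾` (characterized as the point of `Δ₂` nearest to `π⁽ᵗ⁾ + η·r⁽ᵗ⁾`;
this point is unique by strict convexity), then the swap regret of the sequence is at
least `T/1200`; i.e. the maximum over relabelings `ψ : {0,1,2} → {0,1,2}` of
`Σ_t Σ_k π⁽ᵗ⁾_k·(r⁽ᵗ⁾_{ψ(k)} − r⁽ᵗ⁾_k)` is at least `T/1200`. -/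
theorem agile_OGA_linear_swap_regret
    (η : ℝ) (hη0 : 0 < η) (hη2 : η ≤ 1 / 2)
    (m : ℕ) (hm : 0 < m) (hηm : 1 / (2 * η) = (m : ℝ))
    (β : ℕ) (hβ : 0 < β)
    (α : ℕ) (hα : (α : ℝ) = 100 / η)
    (T : ℕ) (hT : T = 3 * α * β)
    (π : ℕ → Fin 3 → ℝ)
    (hπ0 : π 0 = ![1 / 3, 1 / 3, 1 / 3])
    (hπstep : ∀ t, π (t + 1) ∈ simplex2 ∧
      ∀ z ∈ simplex2,
        eudist (π (t + 1)) (fun i => π t i + η * rSeq α t i)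
          ≤ eudist z (fun i => π t i + η * rSeq α t i)) :
    ∃ ψ : Fin 3 → Fin 3,
      (T : ℝ) / 1200 ≤
        ∑ t ∈ Finset.range T, ∑ k, π t k * (rSeq α t (ψ k) - rSeq α t k) := by
  have hαη : η * α = 100 := by rw [hα]; field_simp
  have hmη : η * m = 1 / 2 := by rw [← hηm]; field_simp
  have hαm : α = 200 * m := by
    have : η * α = η * (200 * m : ℝ) := by linarith
    exact_mod_cast mul_left_cancel₀ hη0.ne' this
  have hmem : ∀ t, π t ∈ simplex2 := by
    intro t
    cases t with
    | zero =>
      rw [hπ0]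
      refine ⟨fun i => ?_, ?_⟩
      · fin_cases i <;> norm_num
      · simp; norm_num
    | succ t => exact (hπstep t).1
  have hstep : ∀ t, IsAscentStep η (rSeq α t) (π t) (π (t + 1)) := hπstep
  refine ⟨![1, 1, 2], ?_⟩
  have hterm : ∀ t, ∑ k, π t k * (rSeq α t ((![1, 1, 2] : Fin 3 → Fin 3) k) - rSeq α t k)
      = π t 0 * (rSeq α t 1 - rSeq α t 0) := by
    intro t
    simp [Fin.sum_univ_three]
  simp only [hterm]
  set f : ℕ → ℝ := fun t => π t 0 * (rSeq α t 1 - rSeq α t 0) with hf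
  have hf0 : ∀ t, 0 ≤ f t := fun t => mul_nonneg ((hmem t).1 0) (rSeq_zero_le_one α t)
  have hbatch : ∀ b, (m : ℝ) / 2 ≤ ∑ s ∈ Finset.range (3 * α), f (3 * α * b + s) := by
    intro b
    have hphase := le_of_phase_two hη0 hmem hstep
      (half_le_of_phase_one hη0 hαη hmem hstep (eq_of_batch_start hη0 hαη hπ0 hmem hstep b))
    calc (m : ℝ) / 2 ≤ ∑ s ∈ Finset.range (2 * m), (1 / 2 - η * s / 2) := by
          rw [sum_range_half_sub]
          push_cast
          have : η * (2 * m * (2 * m - 1)) = 2 * m - 1 := by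
            linear_combination 2 * (2 * (m : ℝ) - 1) * hmη
          rw [this]
          linarith
      _ ≤ ∑ s ∈ Finset.range (2 * m), f (3 * α * b + (α + s)) := by
          refine Finset.sum_le_sum fun s hs => ?_
          have hs' : s < α := by have := Finset.mem_range.1 hs; omega
          have hr := rSeq_phase_two (b := b) hs'
          simpa [hf, hr] using hphase s hs'.le
      _ ≤ ∑ s ∈ Finset.range (2 * α), f (3 * α * b + (α + s)) :=
          Finset.sum_le_sum_of_subset_of_nonneg
            (Finset.range_subset_range.2 (by omega)) fun _ _ _ => hf0 _
      _ ≤ ∑ s ∈ Finset.range (3 * α), f (3 * α * b + s) := by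
          rw [show 3 * α = α + 2 * α by ring, Finset.sum_range_add]
          exact le_add_of_nonneg_left (Finset.sum_nonneg fun _ _ => hf0 _)
  have htotal : ∀ b : ℕ, (b : ℝ) * (m / 2) ≤ ∑ t ∈ Finset.range (3 * α * b), f t := by
    intro b
    induction b with
    | zero => simp
    | succ b ih =>
      rw [Nat.mul_succ, Finset.sum_range_add]
      push_cast
      linarith [hbatch b]
  rw [hT]
  refine le_trans (le_of_eq ?_) (htotal β)
  rw [hαm]
  push_cast
  ring
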